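/- Let d ≥ 1, 0 < s < 1, and let Ω ⊆ ℝ^d be open. For any measurable functions u, v : ℝ^d → ℝ, writing u∨v = max{u,v} and u∧v = min{u,v}, one has J^s(u∨v, Ω) + J^s(u∧v, Ω) ≤ J^s(u, Ω) + J^s(v, Ω) (as an inequality in [0,∞]). -/

import Mathlib

open MeasureTheory Metric Set
open scoped ENNReal NNReal

/-- The fractional `s`-energy `J^s(u,Ω)` of `u : ℝ^d → ℝ` on an open set `Ω`:
`J^s(u,Ω) = ∬_{(ℝ^d×ℝ^d)∖(Ωᶜ×Ωᶜ)} |u(x)−u(y)|²/|x−y|^{d+2s} dy dx`, valued in `[0,∞]`. -/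
noncomputable def Js (d : ℕ) (s : ℝ) (u : EuclideanSpace ℝ (Fin d) → ℝ)
    (Ω : Set (EuclideanSpace ℝ (Fin d))) : ℝ≥0∞ :=
  ∫⁻ p : EuclideanSpace ℝ (Fin d) × EuclideanSpace ℝ (Fin d) in (Ωᶜ ×ˢ Ωᶜ)ᶜ,
    ENNReal.ofReal ((u p.1 - u p.2)^2 / ‖p.1 - p.2‖ ^ ((d : ℝ) + 2*s))

/-- Let `d ≥ 1`, `0 < s < 1`, `Ω ⊆ ℝ^d` open. For measurable `u v : ℝ^d → ℝ`,
`J^s(u∨v,Ω) + J^s(u∧v,Ω) ≤ J^s(u,Ω) + J^s(v,Ω)` in `[0,∞]`. -/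
theorem stmt6 (d : ℕ) (hd : 1 ≤ d) (s : ℝ) (hs0 : 0 < s) (hs1 : s < 1)
    (Ω : Set (EuclideanSpace ℝ (Fin d))) (hΩ : IsOpen Ω)
    (u v : EuclideanSpace ℝ (Fin d) → ℝ) (hu : Measurable u) (hv : Measurable v) :
    Js d s (fun x => max (u x) (v x)) Ω + Js d s (fun x => min (u x) (v x)) Ω ≤
      Js d s u Ω + Js d s v Ω := by
  have key : ∀ a b c e : ℝ, (max a b - max c e)^2 + (min a b - min c e)^2
      ≤ (a - c)^2 + (b - e)^2 := by
    intro a b c e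
    rcases le_total a b with h | h <;> rcases le_total c e with h' | h' <;>
      simp only [max_eq_left, max_eq_right, min_eq_left, min_eq_right, h, h'] <;>
      nlinarith [mul_nonneg (sub_nonneg.2 h) (sub_nonneg.2 h')]
  have meas : ∀ w : EuclideanSpace ℝ (Fin d) → ℝ, Measurable w →
      Measurable (fun p : EuclideanSpace ℝ (Fin d) × EuclideanSpace ℝ (Fin d) =>
        ENNReal.ofReal ((w p.1 - w p.2)^2 / ‖p.1 - p.2‖ ^ ((d : ℝ) + 2*s))) := by
    intro w hw
    fun_prop
  unfold Js
  rw [← lintegral_add_left (meas _ (hu.max hv)), ← lintegral_add_left (meas _ hu)]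
  refine lintegral_mono fun p => ?_
  have hn : 0 ≤ ‖p.1 - p.2‖ ^ ((d : ℝ) + 2*s) := by positivity
  dsimp only
  rw [← ENNReal.ofReal_add (by positivity) (by positivity),
    ← ENNReal.ofReal_add (by positivity) (by positivity), ← add_div, ← add_div]
  exact ENNReal.ofReal_le_ofReal (div_le_div_of_nonneg_right (key _ _ _ _) hn)
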